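/- (Lemma 1, part (ii): suboptimality upper bound.) Under the same setup as Lemma 1 part (i) (finite MDP M, behavior policy π_b, n ≥ (C/(d^{π_b}_min)²)·log(1/(δ·d^{π_b}_min)) trajectories, empirical ρ̂0 and P̂, α-unknown set U with α = (C/p_min)·√(log(1/(δ·p_min·d^{π_b}_min))/n_{(s,a)}), (α, Rmax)-pessimistic MDP M̂_p, and ε_π-suboptimal output π_out), the optimal policy π* of M satisfies, with probability at least 1 − C·δ: J_{ρ0}(π*, M) − J_{ρ0}(π_out, M) ≤ ε_π + (2·Rmax/(1−γ))·E[γ^{T_U^{π*}}] + ε_n ≤ ε_π + (2·Rmax/(1−γ)²)·d^{π*,M}(U) + ε_n, where ε_n = (4·C·Rmax/((1−γ)·ρ_{0,min}))·√(log(1/(δ·ρ_{0,min}))/n) + (4·C·γ·Rmax/((1−γ)²·p_min))·√(log(1/(δ·p_min·d^{π_b}_min))/(d^{π_b}_min·n)). -/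

import Mathlib

open scoped ENNReal NNReal
open Classical MeasureTheory

namespace MOReL

universe u v

variable {S : Type u} {A : Type v}

/-- Distribution over trajectory prefixes `(s_0,a_0),…,(s_n,a_n)` generated by executing
policy `π` in the MDP with transition kernel `P` starting from `ρ0`. -/
noncomputable def pathPMF (ρ0 : PMF S) (π : S → PMF A) (P : S → A → PMF S) :
    (n : ℕ) → PMF (Fin (n + 1) → S × A)
  | 0 => ρ0.bind fun s => (π s).map fun a => fun _ => (s, a)
  | n + 1 =>
      (pathPMF ρ0 π P n).bind fun p =>
        (P (p (Fin.last n)).1 (p (Fin.last n)).2).bind fun s' =>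
          (π s').map fun a' => Fin.snoc p (s', a')

/-- Marginal distribution of `(s_t, a_t)`. -/
noncomputable def saDist (ρ0 : PMF S) (π : S → PMF A) (P : S → A → PMF S) (t : ℕ) :
    PMF (S × A) :=
  (pathPMF ρ0 π P t).map fun p => p (Fin.last t)

/-- Expectation of a real-valued function under a PMF. -/
noncomputable def pexp {α : Type*} (μ : PMF α) (f : α → ℝ) : ℝ :=
  ∑' x, (μ x).toReal * f x

/-- The value `J_{ρ0}(π, M) = E[∑_t γ^t r(s_t,a_t)]`. -/
noncomputable def J (ρ0 : PMF S) (π : S → PMF A) (P : S → A → PMF S) (γ : ℝ)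
    (r : S → A → ℝ) : ℝ :=
  ∑' t : ℕ, γ ^ t * pexp (saDist ρ0 π P t) (fun sa => r sa.1 sa.2)

/-- `P(T_V^π = t)`: the probability that the first visit of the executed trajectory to the
state-action set `V` occurs at time `t`. -/
noncomputable def hitProb (ρ0 : PMF S) (π : S → PMF A) (P : S → A → PMF S)
    (V : Set (S × A)) (t : ℕ) : ℝ≥0∞ :=
  (pathPMF ρ0 π P t).toOuterMeasure
    {p | p (Fin.last t) ∈ V ∧ ∀ i : Fin (t + 1), (i : ℕ) < t → p i ∉ V}

/-- `E[γ^{T_V^π}]`, with the convention `γ^∞ = 0`. -/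
noncomputable def discHit (ρ0 : PMF S) (π : S → PMF A) (P : S → A → PMF S) (γ : ℝ)
    (V : Set (S × A)) : ℝ :=
  ∑' t : ℕ, γ ^ t * (hitProb ρ0 π P V t).toReal

/-- Total variation distance between two PMFs. -/
noncomputable def DTV {α : Type*} (p q : PMF α) : ℝ :=
  (1 / 2) * ∑' x, |(p x).toReal - (q x).toReal|

/-- Discounted state-action visitation distribution `d^{π,M}(s,a)`. -/
noncomputable def dVisit (ρ0 : PMF S) (π : S → PMF A) (P : S → A → PMF S) (γ : ℝ)
    (sa : S × A) : ℝ :=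
  (1 - γ) * ∑' t : ℕ, γ ^ t * ((saDist ρ0 π P t) sa).toReal

/-- `d^{π,M}(V)` for a set `V` of state-action pairs. -/
noncomputable def dVisitSet (ρ0 : PMF S) (π : S → PMF A) (P : S → A → PMF S) (γ : ℝ)
    (V : Set (S × A)) : ℝ :=
  ∑' sa : V, dVisit ρ0 π P γ sa

/-- The set of `α`-unknown state-action pairs. -/
def unknown (P Phat : S → A → PMF S) (α : ℝ) : Set (S × A) :=
  {sa | α < DTV (Phat sa.1 sa.2) (P sa.1 sa.2)}

/-- Transition kernel of the pessimistic MDP on `Option S` (`none` is the absorbing state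
HALT): unknown pairs and HALT transition to HALT, known pairs follow `Phat`. -/
noncomputable def pessKernel (Phat : S → A → PMF S) (U : Set (S × A)) :
    Option S → A → PMF (Option S) := fun s a =>
  match s with
  | none => PMF.pure none
  | some s => if (s, a) ∈ U then PMF.pure none else (Phat s a).map some

/-- Reward of the pessimistic MDP: `-κ` at HALT and `r` elsewhere. -/
def pessReward (r : S → A → ℝ) (κ : ℝ) : Option S → A → ℝ := fun s a =>
  match s with
  | none => -κ
  | some s => r s a

/-- Extend a policy on `S` to `Option S` by an arbitrary action distribution at HALT
(the pessimistic value does not depend on this choice). -/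
def extendPolicy (π : S → PMF A) (a0 : PMF A) : Option S → PMF A := fun s =>
  match s with
  | none => a0
  | some s => π s


/-- The geometric distribution `t ↦ (1-γ)γ^t` on `ℕ`. -/
noncomputable def geomPMF (γ : ℝ) (h0 : 0 ≤ γ) (h1 : γ < 1) : PMF ℕ :=
  ⟨fun t => ENNReal.ofReal ((1 - γ) * γ ^ t), by
    have hsum : Summable fun t : ℕ => (1 - γ) * γ ^ t :=
      (summable_geometric_of_lt_one h0 h1).mul_left _
    have h : (∑' t : ℕ, ENNReal.ofReal ((1 - γ) * γ ^ t)) = 1 := by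
      rw [← ENNReal.ofReal_tsum_of_nonneg
        (fun t => mul_nonneg (by linarith) (pow_nonneg h0 t)) hsum]
      rw [tsum_mul_left, tsum_geometric_of_lt_one h0 h1,
        mul_inv_cancel₀ (by linarith : (1 : ℝ) - γ ≠ 0)]
      simp
    rw [← h]
    exact ENNReal.summable.hasSum⟩

/-- The discounted state-action visitation distribution `d^{π,M}` as a PMF: sample a
geometric time `t` and then `(s_t, a_t)`. -/
noncomputable def visitPMF (ρ0 : PMF S) (π : S → PMF A) (P : S → A → PMF S)
    (γ : ℝ) (h0 : 0 ≤ γ) (h1 : γ < 1) : PMF (S × A) :=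
  (geomPMF γ h0 h1).bind (saDist ρ0 π P)

/-- The empirical distribution of `n` sample points. -/
noncomputable def empPMF {α : Type*} {n : ℕ} (hn : 0 < n) (X : Fin n → α) : PMF α :=
  PMF.ofMultiset (Multiset.map X Finset.univ.val) (by
    intro h
    have hc := congrArg Multiset.card h
    simp at hc
    omega)

/-- The distribution of a single data point `(s₀, (s, a, s'))` obtained from a trajectory of
the behavior policy `π` : the initial state `s₀ ∼ ρ0`, a state-action pair `(s,a)` drawn
from the discounted visitation distribution of `π`, and a next state `s' ∼ P(·|s,a)`. -/
noncomputable def sampleDist (ρ0 : PMF S) (π : S → PMF A) (P : S → A → PMF S)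
    (γ : ℝ) (h0 : 0 ≤ γ) (h1 : γ < 1) : PMF (S × S × A × S) :=
  ρ0.bind fun s0 => (visitPMF ρ0 π P γ h0 h1).bind fun sa =>
    (P sa.1 sa.2).map fun s' => (s0, sa.1, sa.2, s')

variable [DecidableEq S] [DecidableEq A]

/-- `n_{(s,a)}`: the number of occurrences of the state-action pair `(s,a)` in the dataset. -/
noncomputable def countSA {n : ℕ} (D : Fin n → S × S × A × S) (sa : S × A) : ℕ :=
  (Finset.univ.filter fun i => ((D i).2.1, (D i).2.2.1) = sa).card

/-- The empirical initial-state distribution `ρ̂0` computed from the dataset. -/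
noncomputable def empInit {n : ℕ} (hn : 0 < n) (D : Fin n → S × S × A × S) : PMF S :=
  empPMF hn fun i => (D i).1

/-- The empirical transition kernel `P̂(·|s,a)` computed from the dataset (an arbitrary
distribution if `(s,a)` does not occur in the dataset). -/
noncomputable def empKernel [Nonempty S] {n : ℕ} (D : Fin n → S × S × A × S) :
    S → A → PMF S := fun s a =>
  let m : Multiset S :=
    (Finset.univ.val.map fun i : Fin n => (D i).2).filterMap
      fun x => if (x.1, x.2.1) = (s, a) then some x.2.2 else none
  if h : m = 0 then PMF.pure (Classical.arbitrary S) else PMF.ofMultiset m h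

end MOReL

namespace MOReL

section Expectation

variable {α β : Type*}

lemma pexp_eq_sum [Fintype α] (μ : PMF α) (f : α → ℝ) :
    pexp μ f = ∑ x, (μ x).toReal * f x := tsum_fintype _

lemma pmf_sum_toReal [Fintype α] (μ : PMF α) : ∑ x, (μ x).toReal = 1 := by
  rw [← ENNReal.toReal_sum (fun x _ => μ.apply_ne_top x), ← tsum_fintype (L := .unconditional _),
    μ.tsum_coe, ENNReal.toReal_one]

lemma pexp_pure [Fintype α] (a : α) (f : α → ℝ) : pexp (PMF.pure a) f = f a := by
  rw [pexp_eq_sum, Finset.sum_eq_single a] <;> simp +contextual [PMF.pure_apply]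

lemma pexp_bind [Fintype α] [Fintype β] (μ : PMF α) (k : α → PMF β) (f : β → ℝ) :
    pexp (μ.bind k) f = pexp μ fun a => pexp (k a) f := by
  simp only [pexp_eq_sum, PMF.bind_apply, tsum_fintype, Finset.mul_sum]
  rw [Finset.sum_comm]
  refine Finset.sum_congr rfl fun y _ => ?_
  rw [ENNReal.toReal_sum
    (fun x _ => ENNReal.mul_ne_top (μ.apply_ne_top x) ((k x).apply_ne_top y)), Finset.sum_mul]
  exact Finset.sum_congr rfl fun x _ => by rw [ENNReal.toReal_mul, mul_assoc]

lemma pexp_map [Fintype α] [Fintype β] (μ : PMF α) (k : α → β) (f : β → ℝ) :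
    pexp (μ.map k) f = pexp μ fun a => f (k a) := by
  rw [← PMF.bind_pure_comp, pexp_bind]
  simp [pexp_pure]

lemma pexp_add [Fintype α] (μ : PMF α) (f g : α → ℝ) :
    pexp μ (fun x => f x + g x) = pexp μ f + pexp μ g := by
  simp only [pexp_eq_sum, mul_add, Finset.sum_add_distrib]

lemma pexp_sub [Fintype α] (μ : PMF α) (f g : α → ℝ) :
    pexp μ (fun x => f x - g x) = pexp μ f - pexp μ g := by
  simp only [pexp_eq_sum, mul_sub, Finset.sum_sub_distrib]

lemma pexp_const_mul [Fintype α] (μ : PMF α) (c : ℝ) (f : α → ℝ) :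
    pexp μ (fun x => c * f x) = c * pexp μ f := by
  simp only [pexp_eq_sum, Finset.mul_sum]
  exact Finset.sum_congr rfl fun x _ => by ring

lemma pexp_const [Fintype α] (μ : PMF α) (c : ℝ) : pexp μ (fun _ => c) = c := by
  rw [pexp_eq_sum, ← Finset.sum_mul, pmf_sum_toReal, one_mul]

lemma pexp_mono [Fintype α] (μ : PMF α) {f g : α → ℝ} (h : ∀ x, f x ≤ g x) :
    pexp μ f ≤ pexp μ g := by
  simp only [pexp_eq_sum]
  exact Finset.sum_le_sum fun x _ => mul_le_mul_of_nonneg_left (h x) ENNReal.toReal_nonneg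

lemma pexp_le_const [Fintype α] (μ : PMF α) {f : α → ℝ} {c : ℝ} (h : ∀ x, f x ≤ c) :
    pexp μ f ≤ c := (pexp_mono μ h).trans_eq (pexp_const μ c)

lemma const_le_pexp [Fintype α] (μ : PMF α) {f : α → ℝ} {c : ℝ} (h : ∀ x, c ≤ f x) :
    c ≤ pexp μ f := (pexp_const μ c).symm.trans_le (pexp_mono μ h)

lemma abs_pexp_le [Fintype α] (μ : PMF α) {f : α → ℝ} {c : ℝ} (h : ∀ x, |f x| ≤ c) :
    |pexp μ f| ≤ c :=
  abs_le.2 ⟨const_le_pexp μ fun x => (abs_le.1 (h x)).1, pexp_le_const μ fun x => (abs_le.1 (h x)).2⟩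

lemma pexp_sub_le_DTV [Fintype α] (μ ν : PMF α) {f : α → ℝ} {c : ℝ} (h : ∀ x, |f x| ≤ c) :
    |pexp μ f - pexp ν f| ≤ 2 * DTV μ ν * c := by
  have : 2 * DTV μ ν * c = ∑ x, |(μ x).toReal - (ν x).toReal| * c := by
    rw [DTV, tsum_fintype, ← Finset.sum_mul]; ring
  rw [this, pexp_eq_sum, pexp_eq_sum, ← Finset.sum_sub_distrib]
  refine (Finset.abs_sum_le_sum_abs _ _).trans (Finset.sum_le_sum fun x _ => ?_)
  rw [← sub_mul, abs_mul]
  exact mul_le_mul_of_nonneg_left (h x) (abs_nonneg _)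

/-- The total variation distance equals the total positive part of the difference. -/
lemma DTV_eq_sum_posPart [Fintype α] (μ ν : PMF α) :
    DTV μ ν = ∑ x, max ((ν x).toReal - (μ x).toReal) 0 := by
  have h : ∀ a b : ℝ, |a - b| = 2 * max (b - a) 0 + (a - b) := fun a b => by
    rcases le_total a b with h | h
    · rw [abs_of_nonpos (by linarith), max_eq_left (by linarith)]; ring
    · rw [abs_of_nonneg (by linarith), max_eq_right (by linarith)]; ring
  rw [DTV, tsum_fintype]
  simp only [h, Finset.sum_add_distrib, Finset.sum_sub_distrib, pmf_sum_toReal, ← Finset.mul_sum]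
  ring

lemma DTV_le_one [Fintype α] (μ ν : PMF α) : DTV μ ν ≤ 1 := by
  rw [DTV_eq_sum_posPart, ← pmf_sum_toReal ν]
  exact Finset.sum_le_sum fun x _ =>
    max_le (sub_le_self _ ENNReal.toReal_nonneg) ENNReal.toReal_nonneg

lemma DTV_self (μ : PMF α) : DTV μ μ = 0 := by simp [DTV]

lemma DTV_map_some [Fintype α] (μ ν : PMF α) : DTV (μ.map some) (ν.map some) = DTV μ ν := by
  have hs : ∀ (μ : PMF α) a, (μ.map some) (some a) = μ a := fun μ a => by
    rw [PMF.map_apply, tsum_fintype, Finset.sum_eq_single a] <;> simp +contextual [eq_comm]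
  have hn : ∀ (μ : PMF α), (μ.map some) none = 0 := fun μ => by
    rw [PMF.map_apply]; simp
  simp only [DTV, tsum_fintype, Fintype.sum_option, hs, hn, sub_self, abs_zero, zero_add]

end Expectation

section Bellman

variable {S A : Type*} [Fintype S] [Fintype A]

/-- One-step expectation of `Q` at the next state-action pair. -/
noncomputable def nextValue (π : S → PMF A) (P : S → A → PMF S) (Q : S → A → ℝ) (s : S) (a : A) :
    ℝ := pexp (P s a) fun s' => pexp (π s') (Q s')

/-- The weighted Bellman equation `Q = g + γ · w · (P Q)`. -/
def IsBellman (π : S → PMF A) (P : S → A → PMF S) (γ : ℝ) (w g Q : S → A → ℝ) : Prop :=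
  ∀ s a, Q s a = g s a + γ * (w s a * nextValue π P Q s a)

lemma nextValue_sub (π : S → PMF A) (P : S → A → PMF S) (Q Q' : S → A → ℝ) (s : S) (a : A) :
    nextValue π P (fun s a => Q s a - Q' s a) s a
      = nextValue π P Q s a - nextValue π P Q' s a := by
  simp only [nextValue, pexp_sub]

lemma nextValue_const_mul (π : S → PMF A) (P : S → A → PMF S) (c : ℝ) (Q : S → A → ℝ)
    (s : S) (a : A) :
    nextValue π P (fun s a => c * Q s a) s a = c * nextValue π P Q s a := by
  simp only [nextValue, pexp_const_mul]

lemma nextValue_le {π : S → PMF A} {P : S → A → PMF S} {Q : S → A → ℝ} {c : ℝ}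
    (h : ∀ s a, Q s a ≤ c) (s : S) (a : A) : nextValue π P Q s a ≤ c :=
  pexp_le_const _ fun s' => pexp_le_const _ (h s')

lemma abs_nextValue_le {π : S → PMF A} {P : S → A → PMF S} {Q : S → A → ℝ} {c : ℝ}
    (h : ∀ s a, |Q s a| ≤ c) (s : S) (a : A) : |nextValue π P Q s a| ≤ c :=
  abs_pexp_le _ fun s' => abs_pexp_le _ (h s')

lemma exists_isBellman (π : S → PMF A) (P : S → A → PMF S) {γ : ℝ} (h0 : 0 ≤ γ) (h1 : γ < 1)
    (w g : S → A → ℝ) (hw : ∀ s a, |w s a| ≤ 1) : ∃ Q, IsBellman π P γ w g Q := by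
  let Φ : (S → A → ℝ) → (S → A → ℝ) := fun Q s a => g s a + γ * (w s a * nextValue π P Q s a)
  have hc : ContractingWith ⟨γ, h0⟩ Φ := by
    refine ⟨by exact_mod_cast h1, LipschitzWith.of_dist_le_mul fun Q Q' => ?_⟩
    have hb : 0 ≤ γ * dist Q Q' := mul_nonneg h0 dist_nonneg
    refine (dist_pi_le_iff hb).2 fun s => (dist_pi_le_iff hb).2 fun a => ?_
    rw [Real.dist_eq]
    have : Φ Q s a - Φ Q' s a
        = γ * (w s a * nextValue π P (fun s a => Q s a - Q' s a) s a) := by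
      rw [nextValue_sub]; simp only [Φ]; ring
    rw [this, abs_mul, abs_mul, abs_of_nonneg h0]
    refine mul_le_mul_of_nonneg_left ?_ h0
    refine (mul_le_mul (hw s a) (abs_nextValue_le (c := dist Q Q') (fun s a => ?_) s a)
      (abs_nonneg _) zero_le_one).trans_eq (one_mul _)
    rw [← Real.dist_eq]
    exact (dist_le_pi_dist (Q s) (Q' s) a).trans (dist_le_pi_dist Q Q' s)
  exact ⟨hc.fixedPoint Φ, fun s a => (congrFun (congrFun hc.fixedPoint_isFixedPt s) a).symm⟩

/-- A discounted maximum principle on finite sets. -/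
lemma le_div_of_discounted {X : Type*} [Finite X] {γ c : ℝ} (h1 : γ < 1) (hc : 0 ≤ c)
    (D : X → ℝ) (h : ∀ M, 0 ≤ M → (∀ y, D y ≤ M) → ∀ x, D x ≤ c + γ * M) (x : X) :
    D x ≤ c / (1 - γ) := by
  have : Nonempty X := ⟨x⟩
  obtain ⟨m, hm⟩ := Finite.exists_max D
  have h1' : 0 < 1 - γ := by linarith
  refine (hm x).trans ?_
  rw [le_div_iff₀ h1']
  rcases le_total (D m) 0 with h0 | h0
  · nlinarith
  · have := h (D m) h0 hm m
    linarith

lemma IsBellman.abs_le {π : S → PMF A} {P : S → A → PMF S} {γ : ℝ} (h0 : 0 ≤ γ) (h1 : γ < 1)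
    {w g Q : S → A → ℝ} (hQ : IsBellman π P γ w g Q) (hw : ∀ s a, |w s a| ≤ 1) {c : ℝ}
    (hg : ∀ s a, |g s a| ≤ c) (s : S) (a : A) : |Q s a| ≤ c / (1 - γ) := by
  have hc : 0 ≤ c := (abs_nonneg _).trans (hg s a)
  refine le_div_of_discounted h1 hc (fun x : S × A => |Q x.1 x.2|) (fun M _ hM x => ?_) (s, a)
  rw [hQ]
  refine (abs_add_le _ _).trans (add_le_add (hg _ _) ?_)
  rw [abs_mul, abs_mul, abs_of_nonneg h0]
  refine mul_le_mul_of_nonneg_left ?_ h0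
  exact (mul_le_mul (hw _ _) (abs_nextValue_le (fun s a => hM (s, a)) _ _)
    (abs_nonneg _) zero_le_one).trans_eq (one_mul _)

/-- Expectation of `g` at the last pair of a path, weighted by `w` along all earlier pairs. -/
noncomputable def pathValue (ρ : PMF S) (π : S → PMF A) (P : S → A → PMF S)
    (w g : S → A → ℝ) (t : ℕ) : ℝ :=
  pexp (pathPMF ρ π P t) fun p =>
    (∏ i : Fin t, w (p i.castSucc).1 (p i.castSucc).2) * g (p (Fin.last t)).1 (p (Fin.last t)).2

lemma pathValue_zero (ρ : PMF S) (π : S → PMF A) (P : S → A → PMF S) (w g : S → A → ℝ) :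
    pathValue ρ π P w g 0 = pexp ρ fun s => pexp (π s) (g s) := by
  simp [pathValue, pathPMF, pexp_bind, pexp_map]

lemma pathValue_succ (ρ : PMF S) (π : S → PMF A) (P : S → A → PMF S) (w g : S → A → ℝ) (t : ℕ) :
    pathValue ρ π P w g (t + 1)
      = pathValue ρ π P w (fun s a => w s a * nextValue π P g s a) t := by
  simp only [pathValue, pathPMF, pexp_bind, pexp_map, Fin.snoc_castSucc, Fin.snoc_last,
    pexp_const_mul, nextValue, Fin.prod_univ_castSucc (n := t), mul_assoc]

lemma pathValue_add_const_mul (ρ : PMF S) (π : S → PMF A) (P : S → A → PMF S)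
    (w g h : S → A → ℝ) (c : ℝ) (t : ℕ) :
    pathValue ρ π P w (fun s a => g s a + c * h s a) t
      = pathValue ρ π P w g t + c * pathValue ρ π P w h t := by
  rw [pathValue, pathValue, pathValue, ← pexp_const_mul, ← pexp_add]
  congr 1; ext p; ring

lemma abs_pathValue_le (ρ : PMF S) (π : S → PMF A) (P : S → A → PMF S) {w g : S → A → ℝ}
    (hw : ∀ s a, |w s a| ≤ 1) {c : ℝ} (hg : ∀ s a, |g s a| ≤ c) (t : ℕ) :
    |pathValue ρ π P w g t| ≤ c := by
  refine abs_pexp_le _ fun p => ?_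
  rw [abs_mul, Finset.abs_prod]
  exact (mul_le_mul (Finset.prod_le_one (fun _ _ => abs_nonneg _) fun _ _ => hw _ _) (hg _ _)
    (abs_nonneg _) zero_le_one).trans_eq (one_mul _)

lemma IsBellman.hasSum {ρ : PMF S} {π : S → PMF A} {P : S → A → PMF S} {γ : ℝ} (h0 : 0 ≤ γ)
    (h1 : γ < 1) {w g Q : S → A → ℝ} (hQ : IsBellman π P γ w g Q) (hw : ∀ s a, |w s a| ≤ 1)
    {c : ℝ} (hg : ∀ s a, |g s a| ≤ c) :
    HasSum (fun t : ℕ => γ ^ t * pathValue ρ π P w g t) (pexp ρ fun s => pexp (π s) (Q s)) := by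
  have hstep : ∀ t, pathValue ρ π P w Q t
      = pathValue ρ π P w g t + γ * pathValue ρ π P w Q (t + 1) := fun t => by
    rw [pathValue_succ, ← pathValue_add_const_mul]
    congr 1
    ext s a
    exact hQ s a
  have hpart : ∀ n, ∑ t ∈ Finset.range n, γ ^ t * pathValue ρ π P w g t
      = pathValue ρ π P w Q 0 - γ ^ n * pathValue ρ π P w Q n := fun n => by
    induction n with
    | zero => simp
    | succ n ih => rw [Finset.sum_range_succ, ih, hstep n]; ring
  have hQb := hQ.abs_le h0 h1 hw hg
  have hsum : Summable fun t : ℕ => γ ^ t * pathValue ρ π P w g t := by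
    refine Summable.of_norm_bounded
      ((summable_geometric_of_lt_one h0 h1).mul_right c) fun t => ?_
    rw [Real.norm_eq_abs, abs_mul, abs_of_nonneg (pow_nonneg h0 t)]
    exact mul_le_mul_of_nonneg_left (abs_pathValue_le ρ π P hw hg t) (pow_nonneg h0 t)
  refine (hsum.hasSum_iff_tendsto_nat).2 ?_
  simp only [hpart, ← pathValue_zero ρ π P w Q]
  have hz : Filter.Tendsto (fun n => γ ^ n * pathValue ρ π P w Q n) Filter.atTop (nhds 0) := by
    refine squeeze_zero_norm (a := fun n => γ ^ n * (c / (1 - γ))) (fun n => ?_) ?_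
    · rw [Real.norm_eq_abs, abs_mul, abs_of_nonneg (pow_nonneg h0 n)]
      exact mul_le_mul_of_nonneg_left (abs_pathValue_le ρ π P hw hQb n) (pow_nonneg h0 n)
    · simpa using (tendsto_pow_atTop_nhds_zero_of_lt_one h0 h1).mul_const (c / (1 - γ))
  simpa using tendsto_const_nhds.sub hz

lemma J_eq_pexp {ρ : PMF S} {π : S → PMF A} {P : S → A → PMF S} {γ : ℝ} (h0 : 0 ≤ γ)
    (h1 : γ < 1) {r Q : S → A → ℝ} (hQ : IsBellman π P γ (fun _ _ => 1) r Q)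
    {R : ℝ} (hr : ∀ s a, |r s a| ≤ R) :
    J ρ π P γ r = pexp ρ fun s => pexp (π s) (Q s) := by
  rw [← (hQ.hasSum (ρ := ρ) h0 h1 (by simp) hr).tsum_eq]
  simp [J, saDist, pexp_map, pathValue]

lemma toReal_toOuterMeasure {α : Type*} [Fintype α] (μ : PMF α) (s : Set α) :
    (μ.toOuterMeasure s).toReal = pexp μ (s.indicator fun _ => 1) := by
  rw [PMF.toOuterMeasure_apply, tsum_fintype, pexp_eq_sum, ENNReal.toReal_sum]
  · refine Finset.sum_congr rfl fun x _ => ?_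
    by_cases h : x ∈ s <;> simp [h]
  · intro x _
    by_cases h : x ∈ s <;> simp [h, μ.apply_ne_top]

lemma hitProb_toReal (ρ : PMF S) (π : S → PMF A) (P : S → A → PMF S) (V : Set (S × A)) (t : ℕ) :
    (hitProb ρ π P V t).toReal = pathValue ρ π P (fun s a => if (s, a) ∈ V then 0 else 1)
      (fun s a => if (s, a) ∈ V then 1 else 0) t := by
  rw [hitProb, toReal_toOuterMeasure, pathValue]
  congr 1
  ext p
  have h1 : (∏ i : Fin t, if p i.castSucc ∈ V then (0 : ℝ) else 1)
      = if ∀ i : Fin t, p i.castSucc ∉ V then 1 else 0 := by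
    have := Finset.prod_boole (s := (Finset.univ : Finset (Fin t)))
      (p := fun i => p i.castSucc ∉ V) (M₀ := ℝ)
    simpa [ite_not] using this
  have h2 : (∀ i : Fin (t + 1), (i : ℕ) < t → p i ∉ V) ↔ ∀ i : Fin t, p i.castSucc ∉ V := by
    simp [Fin.forall_fin_succ']
  simp only [Set.indicator, Set.mem_ofPred_eq, h2, Prod.mk.eta, h1]
  by_cases ha : p (Fin.last t) ∈ V <;> by_cases hb : ∀ i : Fin t, p i.castSucc ∉ V <;>
    simp [ha, hb]

lemma discHit_eq_pexp {ρ : PMF S} {π : S → PMF A} {P : S → A → PMF S} {γ : ℝ} (h0 : 0 ≤ γ)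
    (h1 : γ < 1) {V : Set (S × A)} {H : S → A → ℝ}
    (hH : IsBellman π P γ (fun s a => if (s, a) ∈ V then 0 else 1)
      (fun s a => if (s, a) ∈ V then 1 else 0) H) :
    discHit ρ π P γ V = pexp ρ fun s => pexp (π s) (H s) := by
  rw [← (hH.hasSum (ρ := ρ) (c := 1) h0 h1 _ _).tsum_eq, discHit]
  · simp only [hitProb_toReal]
  all_goals intro s a; split_ifs <;> simp

lemma discHit_le_dVisitSet (ρ : PMF S) (π : S → PMF A) (P : S → A → PMF S) {γ : ℝ} (h0 : 0 ≤ γ)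
    (h1 : γ < 1) (V : Set (S × A)) :
    discHit ρ π P γ V ≤ dVisitSet ρ π P γ V / (1 - γ) := by
  have h1' : 0 < 1 - γ := by linarith
  have hgeo := summable_geometric_of_lt_one h0 h1
  have hsum : ∀ {f : ℕ → ℝ}, (∀ t, 0 ≤ f t) → (∀ t, f t ≤ 1) →
      Summable fun t => γ ^ t * f t := fun hf hf' =>
    Summable.of_nonneg_of_le (fun t => mul_nonneg (pow_nonneg h0 t) (hf t))
      (fun t => mul_le_of_le_one_right (pow_nonneg h0 t) (hf' t)) hgeo
  have hle1 : ∀ {α : Type _} (μ : PMF α) (x : α), (μ x).toReal ≤ 1 := fun μ x =>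
    ENNReal.toReal_mono ENNReal.one_ne_top (μ.coe_le_one x)
  have hd : dVisitSet ρ π P γ V / (1 - γ)
      = ∑' t : ℕ, γ ^ t * pexp (saDist ρ π P t) (V.indicator fun _ => 1) := by
    rw [dVisitSet, tsum_fintype, div_eq_iff h1'.ne', mul_comm]
    simp only [dVisit, ← Finset.mul_sum]
    congr 1
    rw [← Summable.tsum_finsetSum fun sa _ =>
      hsum (fun _ => ENNReal.toReal_nonneg) fun t => hle1 _ _]
    refine tsum_congr fun t => ?_
    rw [← Finset.mul_sum, pexp_eq_sum]
    congr 1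
    rw [← tsum_fintype (L := .unconditional _),
      tsum_subtype V (fun sa => ((saDist ρ π P t) sa).toReal), tsum_fintype]
    refine Finset.sum_congr rfl fun x _ => ?_
    by_cases hx : x ∈ V <;> simp [hx]
  rw [hd, discHit]
  have hi0 : ∀ (t : ℕ), 0 ≤ pexp (saDist ρ π P t) (V.indicator fun _ => 1) := fun t =>
    const_le_pexp _ fun x => Set.indicator_nonneg (fun _ _ => zero_le_one) x
  have hi1 : ∀ (t : ℕ), pexp (saDist ρ π P t) (V.indicator fun _ => 1) ≤ 1 := fun t =>
    pexp_le_const _ fun x => Set.indicator_le_self' (fun _ _ => zero_le_one) x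
  have hle : ∀ t, (hitProb ρ π P V t).toReal
      ≤ pexp (saDist ρ π P t) (V.indicator fun _ => 1) := fun t => by
    rw [hitProb, toReal_toOuterMeasure, saDist, pexp_map]
    refine pexp_mono _ fun p => ?_
    by_cases ha : p (Fin.last t) ∈ V
    · simp only [Set.indicator_of_mem ha]
      exact Set.indicator_le_self' (fun _ _ => zero_le_one) p
    · simp [Set.indicator, ha]
  exact Summable.tsum_le_tsum (fun t => mul_le_mul_of_nonneg_left (hle t) (pow_nonneg h0 t))
    (hsum (fun _ => ENNReal.toReal_nonneg) fun t => (hle t).trans (hi1 t)) (hsum hi0 hi1)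

/-- Simulation lemma: values of two MDPs with close initial distributions and close kernels. -/
lemma abs_J_sub_J_le (ρ ρ' : PMF S) (π : S → PMF A) (P P' : S → A → PMF S) {γ : ℝ} (h0 : 0 ≤ γ)
    (h1 : γ < 1) {r : S → A → ℝ} {R : ℝ} (hR : 0 ≤ R) (hr : ∀ s a, |r s a| ≤ R) {β : ℝ}
    (hβ : 0 ≤ β) (hP : ∀ s a, DTV (P s a) (P' s a) ≤ β) :
    |J ρ π P γ r - J ρ' π P' γ r|
      ≤ 2 * R / (1 - γ) * DTV ρ ρ' + 2 * γ * R / (1 - γ) ^ 2 * β := by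
  have h1' : 0 < 1 - γ := by linarith
  have hone : ∀ (s : S) (a : A), |(fun (_ : S) (_ : A) => (1 : ℝ)) s a| ≤ 1 := by simp
  obtain ⟨Q, hQ⟩ := exists_isBellman π P h0 h1 (fun _ _ => 1) r hone
  obtain ⟨Q', hQ'⟩ := exists_isBellman π P' h0 h1 (fun _ _ => 1) r hone
  have hQb := hQ.abs_le h0 h1 hone hr
  have hQb' := hQ'.abs_le h0 h1 hone hr
  rw [J_eq_pexp h0 h1 hQ hr, J_eq_pexp h0 h1 hQ' hr]
  have hRd : 0 ≤ R / (1 - γ) := div_nonneg hR h1'.le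
  have hdiff : ∀ s a, |Q s a - Q' s a| ≤ 2 * γ * R / (1 - γ) ^ 2 * β := fun s a => by
    have hc : 0 ≤ γ * (2 * β * (R / (1 - γ))) := by positivity
    have := le_div_of_discounted h1 hc (fun x : S × A => |Q x.1 x.2 - Q' x.1 x.2|)
      (fun M _ hM x => ?_) (s, a)
    · refine this.trans_eq ?_
      field_simp
    · obtain ⟨s, a⟩ := x
      have e : Q s a - Q' s a = γ * (nextValue π P Q' s a - nextValue π P' Q' s a)
          + γ * nextValue π P (fun s a => Q s a - Q' s a) s a := by
        rw [nextValue_sub, hQ s a, hQ' s a]; ring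
      dsimp only
      rw [e]
      refine (abs_add_le _ _).trans (add_le_add ?_ ?_)
      · rw [abs_mul, abs_of_nonneg h0]
        refine mul_le_mul_of_nonneg_left ?_ h0
        refine (pexp_sub_le_DTV _ _ (c := R / (1 - γ)) fun s' => abs_pexp_le _ (hQb' s')).trans ?_
        have := hP s a
        gcongr
      · rw [abs_mul, abs_of_nonneg h0]
        exact mul_le_mul_of_nonneg_left (abs_nextValue_le (fun s a => hM (s, a)) s a) h0
  have e : (pexp ρ fun s => pexp (π s) (Q s)) - (pexp ρ' fun s => pexp (π s) (Q' s))
      = ((pexp ρ fun s => pexp (π s) (Q s)) - (pexp ρ' fun s => pexp (π s) (Q s)))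
        + pexp ρ' fun s => pexp (π s) fun a => Q s a - Q' s a := by
    simp only [pexp_sub]; ring
  rw [e]
  refine (abs_add_le _ _).trans (add_le_add ?_ ?_)
  · refine (pexp_sub_le_DTV _ _ (c := R / (1 - γ)) fun s' => abs_pexp_le _ (hQb s')).trans_eq ?_
    ring
  · exact abs_pexp_le _ fun s => abs_pexp_le _ (hdiff s)

end Bellman

section Pessimism

variable {S A : Type*}

lemma abs_pessReward_le {r : S → A → ℝ} {R : ℝ} (hR : 0 ≤ R) (hr : ∀ s a, |r s a| ≤ R)
    (s : Option S) (a : A) : |pessReward r R s a| ≤ R := by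
  cases s with
  | none => simp [pessReward, abs_of_nonneg hR]
  | some s => exact hr s a

variable [Fintype S]

lemma DTV_pessKernel_le {P P' : S → A → PMF S} {U : Set (S × A)} {β : ℝ} (hβ : 0 ≤ β)
    (h : ∀ s a, (s, a) ∉ U → DTV (P s a) (P' s a) ≤ β) (s : Option S) (a : A) :
    DTV (pessKernel P U s a) (pessKernel P' U s a) ≤ β := by
  cases s with
  | none => simpa [pessKernel, DTV_self] using hβ
  | some s =>
    by_cases hU : (s, a) ∈ U
    · simpa [pessKernel, hU, DTV_self] using hβ
    · simpa [pessKernel, hU, DTV_map_some] using h s a hU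

variable [Fintype A]

/-- The value of a policy in the pessimistic MDP built from the true kernel is at most its true
value, and it falls short of the true value by at most the discounted hitting cost. -/
lemma J_pess_bounds (ρ : PMF S) (π : Option S → PMF A) (P : S → A → PMF S) {γ : ℝ} (h0 : 0 ≤ γ)
    (h1 : γ < 1) {r : S → A → ℝ} {R : ℝ} (hR : 0 ≤ R) (hr : ∀ s a, |r s a| ≤ R)
    (U : Set (S × A)) :
    J (ρ.map some) π (pessKernel P U) γ (pessReward r R) ≤ J ρ (fun s => π (some s)) P γ r ∧
    J ρ (fun s => π (some s)) P γ r ≤ J (ρ.map some) π (pessKernel P U) γ (pessReward r R)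
      + 2 * R / (1 - γ) * discHit ρ (fun s => π (some s)) P γ U := by
  have h1' : 0 < 1 - γ := by linarith
  have hRd : 0 ≤ R / (1 - γ) := div_nonneg hR h1'.le
  set π' : S → PMF A := fun s => π (some s)
  obtain ⟨Q, hQ⟩ := exists_isBellman π' P h0 h1 (fun _ _ => 1) r (by simp)
  obtain ⟨Qp, hQp⟩ :=
    exists_isBellman π (pessKernel P U) h0 h1 (fun _ _ => 1) (pessReward r R) (by simp)
  obtain ⟨H, hH⟩ := exists_isBellman π' P h0 h1 (fun s a => if (s, a) ∈ U then 0 else 1)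
    (fun s a => if (s, a) ∈ U then 1 else 0) (by intro s a; split_ifs <;> simp)
  have hQb := hQ.abs_le h0 h1 (by simp) hr
  have hQpb := hQp.abs_le h0 h1 (by simp) (abs_pessReward_le hR hr)
  have hhalt : ∀ a, Qp none a ≤ -(R / (1 - γ)) := fun a => by
    have := le_div_of_discounted h1 le_rfl (fun a => Qp none a + R / (1 - γ))
      (fun M _ hM a => ?_) a
    · rw [zero_div] at this; linarith
    · have e : Qp none a = -R + γ * pexp (π none) (Qp none) := by
        rw [hQp]; simp [nextValue, pessKernel, pessReward, pexp_pure]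
      have : pexp (π none) (Qp none) ≤ M - R / (1 - γ) :=
        pexp_le_const _ fun a => by linarith [hM a]
      have e2 : R = R / (1 - γ) - γ * (R / (1 - γ)) := by field_simp
      rw [e]
      nlinarith [mul_le_mul_of_nonneg_left this h0]
  have hknown : ∀ s a, (s, a) ∉ U →
      Qp (some s) a = r s a + γ * nextValue π' P (fun s => Qp (some s)) s a := fun s a hU => by
    rw [hQp]; simp [nextValue, pessKernel, pessReward, pexp_map, hU, π']
  have hunk : ∀ s a, (s, a) ∈ U → Qp (some s) a ≤ Q s a := fun s a hU => by
    have e : Qp (some s) a = r s a + γ * pexp (π none) (Qp none) := by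
      rw [hQp]; simp [nextValue, pessKernel, pessReward, pexp_pure, hU]
    have h2 : -(R / (1 - γ)) ≤ nextValue π' P Q s a :=
      (abs_le.1 (abs_nextValue_le hQb s a)).1
    rw [e, hQ s a, one_mul]
    exact add_le_add_right (mul_le_mul_of_nonneg_left
      ((pexp_le_const _ hhalt).trans h2) h0) _
  have hlower : ∀ s a, Qp (some s) a ≤ Q s a := fun s a => by
    have := le_div_of_discounted h1 le_rfl (fun x : S × A => Qp (some x.1) x.2 - Q x.1 x.2)
      (fun M hM0 hM x => ?_) (s, a)
    · rw [zero_div] at this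
      exact sub_nonpos.1 this
    · obtain ⟨s, a⟩ := x
      by_cases hU : (s, a) ∈ U
      · have := hunk s a hU
        nlinarith [mul_nonneg h0 hM0]
      · have e : Qp (some s) a - Q s a
            = γ * nextValue π' P (fun s a => Qp (some s) a - Q s a) s a := by
          rw [nextValue_sub, hknown s a hU, hQ s a]; ring
        rw [zero_add, e]
        exact mul_le_mul_of_nonneg_left (nextValue_le (fun s a => hM (s, a)) s a) h0
  have hupper : ∀ s a, Q s a ≤ Qp (some s) a + 2 * R / (1 - γ) * H s a := fun s a => by
    have := le_div_of_discounted h1 le_rfl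
      (fun x : S × A => Q x.1 x.2 - Qp (some x.1) x.2 - 2 * R / (1 - γ) * H x.1 x.2)
      (fun M hM0 hM x => ?_) (s, a)
    · rw [zero_div] at this
      linarith
    · obtain ⟨s, a⟩ := x
      by_cases hU : (s, a) ∈ U
      · have h2 := (abs_le.1 (hQb s a)).2
        have h3 := (abs_le.1 (hQpb (some s) a)).1
        have h4 : H s a = 1 := by rw [hH]; simp [hU]
        have e : 2 * R / (1 - γ) = R / (1 - γ) + R / (1 - γ) := by ring
        rw [h4, e]
        nlinarith [mul_nonneg h0 hM0]
      · have h4 : H s a = γ * nextValue π' P H s a := by rw [hH]; simp [hU]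
        have e : Q s a - Qp (some s) a - 2 * R / (1 - γ) * H s a
            = γ * nextValue π' P
              (fun s a => Q s a - Qp (some s) a - 2 * R / (1 - γ) * H s a) s a := by
          rw [nextValue_sub π' P (fun s a => Q s a - Qp (some s) a), nextValue_sub,
            nextValue_const_mul, hknown s a hU, hQ s a, h4]
          ring
        rw [zero_add, e]
        exact mul_le_mul_of_nonneg_left (nextValue_le (fun s a => hM (s, a)) s a) h0
  rw [J_eq_pexp h0 h1 hQ hr, J_eq_pexp h0 h1 hQp (abs_pessReward_le hR hr), pexp_map,
    discHit_eq_pexp h0 h1 hH, ← pexp_const_mul, ← pexp_add]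
  refine ⟨pexp_mono _ fun s => pexp_mono _ (hlower s), pexp_mono _ fun s => ?_⟩
  rw [← pexp_const_mul, ← pexp_add]
  exact pexp_mono _ (hupper s)

/-- Suboptimality of an approximately optimal policy of an estimated pessimistic MDP, when the
estimates of the initial distribution and of the kernel on known pairs are accurate. -/
lemma suboptimality_of_estimates (ρ ρ' : PMF S) (P P' : S → A → PMF S) {γ : ℝ} (h0 : 0 ≤ γ)
    (h1 : γ < 1) {r : S → A → ℝ} {R : ℝ} (hR : 0 ≤ R) (hr : ∀ s a, |r s a| ≤ R)
    (U : Set (S × A)) {β η : ℝ} (hβ : 0 ≤ β) (hP : ∀ s a, (s, a) ∉ U → DTV (P' s a) (P s a) ≤ β)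
    (hρ : DTV ρ' ρ ≤ η) (π : S → PMF A) {ε : ℝ} (πout : Option S → PMF A)
    (hopt : ∀ πe : Option S → PMF A, J (ρ'.map some) πe (pessKernel P' U) γ (pessReward r R)
      ≤ J (ρ'.map some) πout (pessKernel P' U) γ (pessReward r R) + ε) :
    J ρ π P γ r - J ρ (fun s => πout (some s)) P γ r
      ≤ ε + 2 * R / (1 - γ) * discHit ρ π P γ U
        + (4 * R / (1 - γ) * η + 4 * γ * R / (1 - γ) ^ 2 * β) := by
  have h1' : 0 < 1 - γ := by linarith
  obtain ⟨s₀, -⟩ := ρ.support_nonempty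
  let πe : Option S → PMF A := extendPolicy π (π s₀)
  have hsim := fun π => abs_le.1 (abs_J_sub_J_le (ρ'.map some) (ρ.map some) π (pessKernel P' U)
    (pessKernel P U) h0 h1 hR (abs_pessReward_le hR hr) hβ (DTV_pessKernel_le hβ hP))
  simp only [DTV_map_some] at hsim
  have hη : 2 * R / (1 - γ) * DTV ρ' ρ ≤ 2 * R / (1 - γ) * η :=
    mul_le_mul_of_nonneg_left hρ (by positivity)
  have ha := (J_pess_bounds ρ πout P h0 h1 hR hr U).1
  have hb := (J_pess_bounds ρ πe P h0 h1 hR hr U).2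
  have hc := hopt πe
  have hd := (hsim πout).2
  have he := (hsim πe).1
  have e1 : 4 * R / (1 - γ) * η = 2 * (2 * R / (1 - γ) * η) := by ring
  have e2 : 4 * γ * R / (1 - γ) ^ 2 * β = 2 * (2 * γ * R / (1 - γ) ^ 2 * β) := by ring
  rw [e1, e2]
  change J ρ π P γ r ≤ _ + 2 * R / (1 - γ) * discHit ρ π P γ U at hb
  linarith

end Pessimism

section Concentration

variable {X : Type*} [MeasurableSpace X] [MeasurableSingletonClass X]

lemma ae_forall_pmf_ne_zero (q : PMF X) (n : ℕ) :
    ∀ᵐ D ∂Measure.pi (fun _ : Fin n => q.toMeasure), ∀ i, q (D i) ≠ 0 := by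
  refine ae_all_iff.2 fun i => ?_
  have h : ∀ᵐ x ∂q.toMeasure, q x ≠ 0 := by
    rw [ae_iff, PMF.toMeasure_apply_eq_toOuterMeasure, PMF.toOuterMeasure_apply_eq_zero_iff]
    exact Set.disjoint_left.2 fun x hx => by simpa using (q.mem_support_iff x).1 hx
  exact (Measure.tendsto_eval_ae_ae (μ := fun _ : Fin n => q.toMeasure) (i := i)).eventually h

variable [Fintype X]

lemma measure_sum_ge_le_exp (q : PMF X) (n : ℕ) (f : X → ℝ) (hf : ∀ x, |f x| ≤ 1)
    (hmean : pexp q f = 0) {v : ℝ} (hvar : pexp q (fun x => f x ^ 2) ≤ v) {l : ℝ} (hl0 : 0 ≤ l)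
    (hl1 : l ≤ 1) (t : ℝ) :
    Measure.pi (fun _ : Fin n => q.toMeasure) {D : Fin n → X | t ≤ ∑ i, f (D i)}
      ≤ ENNReal.ofReal (Real.exp (n * (l ^ 2 * v) - l * t)) := by
  set μ := Measure.pi (fun _ : Fin n => q.toMeasure)
  have hmgf : pexp q (fun x => Real.exp (l * f x)) ≤ Real.exp (l ^ 2 * v) := by
    have h1 : ∀ x, Real.exp (l * f x) ≤ (1 + l * f x) + l ^ 2 * f x ^ 2 := fun x => by
      have hx : |l * f x| ≤ 1 := by
        rw [abs_mul, abs_of_nonneg hl0]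
        exact mul_le_one₀ hl1 (abs_nonneg _) (hf x)
      have := (abs_le.1 (Real.abs_exp_sub_one_sub_id_le hx)).2
      linarith [mul_pow l (f x) 2]
    refine (pexp_mono q h1).trans ?_
    rw [pexp_add, pexp_add, pexp_const, pexp_const_mul, pexp_const_mul, hmean]
    have := Real.add_one_le_exp (l ^ 2 * v)
    nlinarith [mul_le_mul_of_nonneg_left hvar (sq_nonneg l)]
  have hint : ∫ D, Real.exp (l * ∑ i, f (D i)) ∂μ ≤ Real.exp (n * (l ^ 2 * v)) := by
    simp only [Finset.mul_sum, Real.exp_sum]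
    rw [integral_fintype_prod_eq_prod (fun (_ : Fin n) x => Real.exp (l * f x)),
      Finset.prod_const, Finset.card_univ, Fintype.card_fin, PMF.integral_eq_sum]
    simp only [smul_eq_mul]
    rw [← pexp_eq_sum, Real.exp_nat_mul]
    exact pow_le_pow_left₀ (const_le_pexp q fun x => (Real.exp_pos _).le) hmgf n
  have hmarkov := mul_meas_ge_le_integral_of_nonneg (μ := μ)
    (f := fun D => Real.exp (l * ∑ i, f (D i)))
    (Filter.Eventually.of_forall fun D => (Real.exp_pos _).le) Integrable.of_finite
    (Real.exp (l * t))
  have hsub : {D : Fin n → X | t ≤ ∑ i, f (D i)}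
      ⊆ {D | Real.exp (l * t) ≤ Real.exp (l * ∑ i, f (D i))} := fun D hD =>
    Real.exp_le_exp.2 (mul_le_mul_of_nonneg_left hD hl0)
  refine (measure_mono hsub).trans ?_
  rw [← ofReal_measureReal]
  refine ENNReal.ofReal_le_ofReal ?_
  rw [Real.exp_sub, le_div_iff₀ (Real.exp_pos _), mul_comm]
  exact hmarkov.trans hint

lemma measure_sum_ge_sqrt_le (q : PMF X) {n : ℕ} (hn : 0 < n) (f : X → ℝ) (hf : ∀ x, |f x| ≤ 1)
    (hmean : pexp q f = 0) {v : ℝ} (hv : 0 < v) (hvar : pexp q (fun x => f x ^ 2) ≤ v) {L : ℝ}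
    (hL : 0 ≤ L) (hLv : L ≤ n * v) :
    Measure.pi (fun _ : Fin n => q.toMeasure)
        {D : Fin n → X | 2 * √(L * (n * v)) ≤ ∑ i, f (D i)}
      ≤ ENNReal.ofReal (Real.exp (-L)) := by
  have hnv : 0 < n * v := by positivity
  have hl : √(L / (n * v)) ≤ 1 := Real.sqrt_le_one.2 ((div_le_one hnv).2 hLv)
  refine (measure_sum_ge_le_exp q n f hf hmean hvar (Real.sqrt_nonneg _) hl _).trans_eq ?_
  have h1 : √(L / (n * v)) ^ 2 = L / (n * v) := Real.sq_sqrt (by positivity)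
  have h2 : √(L / (n * v)) * √(L * (n * v)) = L := by
    rw [← Real.sqrt_mul (by positivity), Real.sqrt_eq_iff_mul_self_eq (by positivity) hL]
    field_simp
  have e : n * (√(L / (n * v)) ^ 2 * v) - √(L / (n * v)) * (2 * √(L * (n * v))) = -L := by
    have h3 : √(L / (n * v)) ^ 2 * (n * v) = L := by
      rw [h1]
      field_simp
    linear_combination h3 - 2 * h2
  rw [e]

end Concentration

section Support

variable {α : Type*}

lemma le_one_of_le_support (p : PMF α) {c : ℝ} (hp : ∀ a, p a ≠ 0 → c ≤ (p a).toReal) :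
    c ≤ 1 := by
  obtain ⟨a, ha⟩ := p.support_nonempty
  exact (hp a ha).trans (ENNReal.toReal_mono ENNReal.one_ne_top (p.coe_le_one a))

variable [Fintype α]

lemma card_support_mul_le_one (p : PMF α) {c : ℝ} (hp : ∀ a, p a ≠ 0 → c ≤ (p a).toReal) :
    ((Finset.univ.filter fun a => p a ≠ 0).card : ℝ) * c ≤ 1 := by
  rw [← pmf_sum_toReal p, ← nsmul_eq_mul]
  refine (Finset.card_nsmul_le_sum _ _ _ fun a ha => hp a (Finset.mem_filter.1 ha).2).trans ?_
  exact Finset.sum_le_univ_sum_of_nonneg fun _ => ENNReal.toReal_nonneg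

lemma DTV_le_div (p' p : PMF α) {c e : ℝ} (hc : 0 < c) (he : 0 ≤ e)
    (hp : ∀ a, p a ≠ 0 → c ≤ (p a).toReal)
    (h : ∀ a, p a ≠ 0 → (p a).toReal - (p' a).toReal ≤ e) : DTV p' p ≤ e / c := by
  rw [DTV_eq_sum_posPart, le_div_iff₀ hc]
  have hs : ∑ a, max ((p a).toReal - (p' a).toReal) 0
      ≤ (Finset.univ.filter fun a => p a ≠ 0).card * e := by
    rw [← nsmul_eq_mul, ← Finset.sum_const, Finset.sum_filter]
    refine Finset.sum_le_sum fun a _ => ?_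
    split_ifs with ha
    · exact max_le (h a ha) he
    · rw [not_not] at ha
      simp [ha]
  nlinarith [card_support_mul_le_one p hp]

lemma measure_exists_support_le {Ω : Type*} [MeasurableSpace Ω] (μ : Measure Ω) (p : PMF α)
    {c δ : ℝ} (hδ : 0 ≤ δ) (hp : ∀ a, p a ≠ 0 → c ≤ (p a).toReal) (B : α → Set Ω)
    (hB : ∀ a, p a ≠ 0 → μ (B a) ≤ ENNReal.ofReal (c * δ)) :
    μ {ω | ∃ a, p a ≠ 0 ∧ ω ∈ B a} ≤ ENNReal.ofReal δ := by
  have e : {ω | ∃ a, p a ≠ 0 ∧ ω ∈ B a} = ⋃ a ∈ Finset.univ.filter (fun a => p a ≠ 0), B a := by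
    ext ω; simp
  rw [e]
  refine (measure_biUnion_finset_le _ _).trans ?_
  refine (Finset.sum_le_card_nsmul _ _ _ fun a ha => hB a (Finset.mem_filter.1 ha).2).trans ?_
  rw [← ENNReal.ofReal_nsmul, nsmul_eq_mul, ← mul_assoc]
  exact ENNReal.ofReal_le_ofReal
    (mul_le_of_le_one_left hδ (card_support_mul_le_one p hp))

end Support

section Empirical

variable {S A : Type*}

lemma empPMF_toReal {α : Type*} [DecidableEq α] {n : ℕ} (hn : 0 < n) (X : Fin n → α) (a : α) :
    (empPMF hn X a).toReal = (∑ i, if X i = a then (1 : ℝ) else 0) / n := by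
  rw [empPMF, PMF.ofMultiset_apply, Multiset.count_map, ENNReal.toReal_div]
  simp only [ENNReal.toReal_natCast, Multiset.card_map, Finset.card_val, Finset.card_univ,
    Fintype.card_fin, Finset.sum_boole]
  congr 2
  rw [← Finset.filter_val, Finset.card_val]
  congr 1
  ext i
  simp [eq_comm]

variable [DecidableEq S] [DecidableEq A]

lemma empKernel_toReal [Nonempty S] {n : ℕ} (D : Fin n → S × S × A × S) (x : S × A) (y : S)
    (h : (∑ i, if ((D i).2.1, (D i).2.2.1) = x then (1 : ℝ) else 0) ≠ 0) :
    (empKernel D x.1 x.2 y).toReal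
      = (∑ i, if ((D i).2.1, (D i).2.2.1) = x then (if (D i).2.2.2 = y then (1 : ℝ) else 0) else 0)
        / ∑ i, if ((D i).2.1, (D i).2.2.1) = x then (1 : ℝ) else 0 := by
  let g : S × A × S → Option S := fun z => if (z.1, z.2.1) = (x.1, x.2) then some z.2.2 else none
  have hcard : ∀ t : Multiset (Fin n),
      ((((t.map fun i => (D i).2).filterMap g).card : ℕ) : ℝ)
        = (t.map fun i => if ((D i).2.1, (D i).2.2.1) = x then (1 : ℝ) else 0).sum := fun t => by
    induction t using Multiset.induction_on with
    | empty => simp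
    | cons i t ih =>
      by_cases hx : ((D i).2.1, (D i).2.2.1) = x <;>
        simp only [Multiset.map_cons, Multiset.sum_cons, Multiset.filterMap_cons, ← ih, g, hx] <;>
        simp [add_comm]
  have hcount : ∀ t : Multiset (Fin n),
      ((((t.map fun i => (D i).2).filterMap g).count y : ℕ) : ℝ)
        = (t.map fun i => if ((D i).2.1, (D i).2.2.1) = x then
            (if (D i).2.2.2 = y then (1 : ℝ) else 0) else 0).sum := fun t => by
    induction t using Multiset.induction_on with
    | empty => simp
    | cons i t ih =>
      by_cases hx : ((D i).2.1, (D i).2.2.1) = x <;> by_cases hy : (D i).2.2.2 = y <;>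
        simp only [Multiset.map_cons, Multiset.sum_cons, Multiset.filterMap_cons, ← ih, g, hx,
          hy] <;>
        simp [add_comm, hy, @eq_comm S y]
  have hm : ((Finset.univ.val.map fun i : Fin n => (D i).2).filterMap g) ≠ 0 := fun h0 => by
    have := hcard Finset.univ.val
    rw [h0, Multiset.card_zero, Nat.cast_zero] at this
    exact h this.symm
  have e : empKernel D x.1 x.2 = PMF.ofMultiset _ hm := by
    simp only [empKernel]
    exact dif_neg hm
  rw [e, PMF.ofMultiset_apply, ENNReal.toReal_div, ENNReal.toReal_natCast, ENNReal.toReal_natCast,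
    hcard]
  congr 1
  convert hcount Finset.univ.val
  rfl

end Empirical

section Sampling

lemma toReal_mem_unit {α : Type*} (p : PMF α) (a : α) :
    0 ≤ (p a).toReal ∧ (p a).toReal ≤ 1 :=
  ⟨ENNReal.toReal_nonneg, ENNReal.toReal_mono ENNReal.one_ne_top (p.coe_le_one a)⟩

lemma sqrt_mul_div_self {L m : ℝ} (hm : 0 < m) : √(L * m) / m = √(L / m) := by
  rw [div_eq_iff hm.ne', ← Real.sqrt_sq hm.le, ← Real.sqrt_mul' _ (sq_nonneg _),
    Real.sqrt_sq hm.le]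
  congr 1
  field_simp

variable {S A : Type*}

lemma visitPMF_ne_zero_of_sampleDist (ρ0 : PMF S) (π : S → PMF A) (P : S → A → PMF S) {γ : ℝ}
    (h0 : 0 ≤ γ) (h1 : γ < 1) {x : S × S × A × S} (hx : sampleDist ρ0 π P γ h0 h1 x ≠ 0) :
    visitPMF ρ0 π P γ h0 h1 (x.2.1, x.2.2.1) ≠ 0 := by
  rw [← PMF.mem_support_iff] at hx ⊢
  simp only [sampleDist, PMF.mem_support_bind_iff, PMF.mem_support_map_iff] at hx
  obtain ⟨s0, -, sa, hsa, s', -, rfl⟩ := hx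
  exact hsa

variable [Fintype S] [Fintype A]

lemma pexp_sampleDist (ρ0 : PMF S) (π : S → PMF A) (P : S → A → PMF S) {γ : ℝ} (h0 : 0 ≤ γ)
    (h1 : γ < 1) (f : S × S × A × S → ℝ) :
    pexp (sampleDist ρ0 π P γ h0 h1) f = pexp ρ0 fun s0 => pexp (visitPMF ρ0 π P γ h0 h1)
      fun x => pexp (P x.1 x.2) fun s' => f (s0, x.1, x.2, s') := by
  simp only [sampleDist, pexp_bind, pexp_map]

lemma pexp_ite_eq {α : Type*} [Fintype α] [DecidableEq α] (p : PMF α) (a : α) (c : ℝ) :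
    pexp p (fun x => if x = a then c else 0) = (p a).toReal * c := by
  simp [pexp_eq_sum]

variable [DecidableEq S] [MeasurableSpace (S × S × A × S)]
  [MeasurableSingletonClass (S × S × A × S)]

lemma measure_empInit_le (ρ0 : PMF S) (π : S → PMF A) (P : S → A → PMF S) {γ : ℝ} (h0 : 0 ≤ γ)
    (h1 : γ < 1) {ρmin δ : ℝ} (hρ : 0 < ρmin) (hmin : ∀ s, ρ0 s ≠ 0 → ρmin ≤ (ρ0 s).toReal)
    (hδ : 0 < δ) (hδ1 : δ ≤ 1) {n : ℕ} (hn : 0 < n) :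
    Measure.pi (fun _ : Fin n => (sampleDist ρ0 π P γ h0 h1).toMeasure)
        {D | ¬ DTV (empInit hn D) ρ0 ≤ 4 / ρmin * √(Real.log (1 / (δ * ρmin)) / n)}
      ≤ ENNReal.ofReal δ := by
  have hρ1 := le_one_of_le_support ρ0 hmin
  have hn' : (0 : ℝ) < n := Nat.cast_pos.2 hn
  have hpos : 0 < δ * ρmin := mul_pos hδ hρ
  set L := Real.log (1 / (δ * ρmin)) with hLdef
  have hL : 0 ≤ L := Real.log_nonneg
    ((one_le_div hpos).2 (mul_le_one₀ hδ1 hρ.le hρ1))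
  have hexp : Real.exp (-L) = ρmin * δ := by
    rw [hLdef, one_div, Real.log_inv, neg_neg, Real.exp_log hpos, mul_comm]
  rcases le_or_gt L n with hLn | hLn
  · refine (measure_mono ?_).trans (measure_exists_support_le _ ρ0 hδ.le hmin
      (fun s => {D | 2 * √(L * (n * 1)) ≤ ∑ i, ((ρ0 s).toReal - if (D i).1 = s then 1 else 0)})
      fun s _ => ?_)
    · intro D hD
      by_contra hcon
      refine hD ?_
      simp only [Set.mem_ofPred_eq, not_exists, not_and, not_le, mul_one] at hcon
      refine (DTV_le_div (e := 2 * √(L / n)) _ _ hρ (by positivity) hmin fun s hs => ?_).trans ?_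
      · have := hcon s hs
        rw [Finset.sum_sub_distrib, Finset.sum_const, Finset.card_univ, Fintype.card_fin,
          nsmul_eq_mul] at this
        rw [empInit, empPMF_toReal, ← sqrt_mul_div_self hn', ← mul_div_assoc, le_div_iff₀ hn',
          sub_mul, div_mul_cancel₀ _ hn'.ne']
        linarith
      · rw [mul_div_right_comm]
        gcongr
        norm_num
    · rw [← hexp]
      have hb : ∀ x : S × S × A × S, |(ρ0 s).toReal - if x.1 = s then 1 else 0| ≤ 1 := fun x => by
        obtain ⟨ha, hb⟩ := toReal_mem_unit ρ0 s
        rw [abs_le]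
        split_ifs <;> constructor <;> linarith
      refine measure_sum_ge_sqrt_le _ hn
        (fun x : S × S × A × S => (ρ0 s).toReal - if x.1 = s then 1 else 0) hb ?_ one_pos ?_ hL
        (by simpa using hLn)
      · rw [pexp_sampleDist]
        refine (congrArg (pexp ρ0) (funext fun s0 =>
          (congrArg (pexp _) (funext fun z => pexp_const _ _)).trans (pexp_const _ _))).trans
          (b := pexp ρ0 fun s0 => (ρ0 s).toReal - if s0 = s then 1 else 0) ?_
        rw [pexp_sub, pexp_const, pexp_ite_eq, mul_one, sub_self]
      · exact pexp_le_const _ fun x => (sq_le_one_iff_abs_le_one _).2 (hb x)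
  · refine (measure_mono_null ?_ measure_empty).trans_le zero_le
    intro D hD
    refine hD ((DTV_le_one _ _).trans ?_)
    have h2 : 1 ≤ √(L / n) := Real.one_le_sqrt.2 ((one_le_div hn').2 hLn.le)
    have h3 : 1 ≤ 4 / ρmin := (one_le_div hρ).2 (by linarith)
    nlinarith

variable [DecidableEq A]

lemma measure_empKernel_le [Nonempty S] (ρ0 : PMF S) (π : S → PMF A) (P : S → A → PMF S) {γ : ℝ}
    (h0 : 0 ≤ γ) (h1 : γ < 1) {pmin dmin δ : ℝ} (hp : 0 < pmin)
    (hpmin : ∀ s a s', P s a s' ≠ 0 → pmin ≤ (P s a s').toReal) (hd : 0 < dmin)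
    (hdmin : ∀ x, visitPMF ρ0 π P γ h0 h1 x ≠ 0 → dmin ≤ (visitPMF ρ0 π P γ h0 h1 x).toReal)
    (hδ : 0 < δ) (hδ1 : δ ≤ 1) {n : ℕ} (hn : 0 < n) :
    Measure.pi (fun _ : Fin n => (sampleDist ρ0 π P γ h0 h1).toMeasure)
        {D | ¬ ∀ x, visitPMF ρ0 π P γ h0 h1 x ≠ 0 → DTV (empKernel D x.1 x.2) (P x.1 x.2)
          ≤ 4 / pmin * √(Real.log (1 / (δ * pmin * dmin)) / (dmin * n))}
      ≤ ENNReal.ofReal δ + ENNReal.ofReal δ := by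
  set d := visitPMF ρ0 π P γ h0 h1 with hddef
  obtain ⟨x₀, -⟩ := d.support_nonempty
  have hp1 := le_one_of_le_support (P x₀.1 x₀.2) (hpmin x₀.1 x₀.2)
  have hd1 := le_one_of_le_support d hdmin
  have hn' : (0 : ℝ) < n := Nat.cast_pos.2 hn
  have hpos : 0 < δ * pmin * dmin := by positivity
  set L := Real.log (1 / (δ * pmin * dmin)) with hLdef
  have hL : 0 ≤ L := Real.log_nonneg
    ((one_le_div hpos).2 (mul_le_one₀ (mul_le_one₀ hδ1 hp.le hp1) hd.le hd1))
  have hexp : Real.exp (-L) = pmin * (dmin * δ) := by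
    rw [hLdef, one_div, Real.log_inv, neg_neg, Real.exp_log hpos]; ring
  have hdn : 0 < dmin * n := by positivity
  rcases le_or_gt (16 * L) (dmin * n) with hLn | hLn
  · have hbig : ∀ x, d x ≠ 0 → 16 * L ≤ n * (d x).toReal := fun x hx => by
      have := hdmin x hx
      nlinarith
    let cnt : (Fin n → S × S × A × S) → S × A → ℝ := fun D x =>
      ∑ i, if ((D i).2.1, (D i).2.2.1) = x then (1 : ℝ) else 0
    let BN : S × A → Set (Fin n → S × S × A × S) := fun x =>
      {D | 2 * √(L * (n * (d x).toReal)) ≤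
        ∑ i, ((d x).toReal - if ((D i).2.1, (D i).2.2.1) = x then 1 else 0)}
    let BT : S × A → S → Set (Fin n → S × S × A × S) := fun x y =>
      {D | 2 * √(L * (n * (d x).toReal)) ≤
        ∑ i, if ((D i).2.1, (D i).2.2.1) = x then
          ((P x.1 x.2 y).toReal - if (D i).2.2.2 = y then 1 else 0) else 0}
    have hvpos : ∀ x, d x ≠ 0 → 0 < (d x).toReal := fun x hx => hd.trans_le (hdmin x hx)
    refine (measure_mono (t := {D | ∃ x, d x ≠ 0 ∧ D ∈ BN x} ∪
      {D | ∃ x, d x ≠ 0 ∧ D ∈ {D | ∃ y, P x.1 x.2 y ≠ 0 ∧ D ∈ BT x y}}) ?_).trans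
      ((measure_union_le _ _).trans (add_le_add
        (measure_exists_support_le _ d hδ.le hdmin BN fun x hx => ?_)
        (measure_exists_support_le _ d hδ.le hdmin _ fun x hx =>
          measure_exists_support_le _ (P x.1 x.2) (by positivity) (hpmin x.1 x.2) (BT x)
            fun y hy => ?_)))
    · intro D hD
      by_contra hcon
      refine hD fun x hx => ?_
      simp only [BN, BT, Set.mem_union, Set.mem_ofPred_eq, not_or, not_exists, not_and,
        not_le] at hcon
      have hv := hvpos x hx
      have hnv : 0 < n * (d x).toReal := by positivity
      have hN := hcon.1 x hx
      rw [Finset.sum_sub_distrib, Finset.sum_const, Finset.card_univ, Fintype.card_fin,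
        nsmul_eq_mul] at hN
      have hsq : √(L * (n * (d x).toReal)) ≤ n * (d x).toReal / 4 := by
        refine Real.sqrt_le_iff.2 ⟨by positivity, ?_⟩
        nlinarith [hbig x hx]
      have hcnt : n * (d x).toReal / 2 < cnt D x := by
        simp only [cnt]
        linarith
      have hcnt0 : 0 < cnt D x := by linarith
      refine (DTV_le_div (e := 4 * √(L / (dmin * n))) _ _ hp (by positivity) (hpmin x.1 x.2)
        fun y hy => ?_).trans_eq (by ring)
      have hT := hcon.2 x hx y hy
      rw [empKernel_toReal D x y hcnt0.ne']
      have hsplit : (∑ i, if ((D i).2.1, (D i).2.2.1) = x then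
          ((P x.1 x.2 y).toReal - if (D i).2.2.2 = y then 1 else 0) else 0)
          = (P x.1 x.2 y).toReal * cnt D x - ∑ i, if ((D i).2.1, (D i).2.2.1) = x then
            (if (D i).2.2.2 = y then (1 : ℝ) else 0) else 0 := by
        simp only [cnt, Finset.mul_sum]
        rw [← Finset.sum_sub_distrib]
        refine Finset.sum_congr rfl fun i _ => ?_
        split_ifs <;> simp
      rw [hsplit] at hT
      have hmono : √(L / (n * (d x).toReal)) ≤ √(L / (dmin * n)) := by
        refine Real.sqrt_le_sqrt (div_le_div_of_nonneg_left hL hdn ?_)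
        rw [mul_comm]
        exact mul_le_mul_of_nonneg_left (hdmin x hx) hn'.le
      refine le_trans ?_ (mul_le_mul_of_nonneg_left hmono (by norm_num))
      rw [← sqrt_mul_div_self hnv, sub_le_iff_le_add, ← sub_le_iff_le_add',
        ← mul_le_mul_iff_of_pos_right hcnt0, sub_mul, div_mul_cancel₀ _ hcnt0.ne']
      have hs0 : 0 ≤ √(L * (n * (d x).toReal)) := Real.sqrt_nonneg _
      have key : 2 * √(L * (n * (d x).toReal))
          ≤ 4 * (√(L * (n * (d x).toReal)) / (n * (d x).toReal)) * cnt D x := by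
        rw [← mul_div_assoc, div_mul_eq_mul_div, le_div_iff₀ hnv]
        nlinarith
      linarith
    · have hb : ∀ z : S × S × A × S,
          |(d x).toReal - if (z.2.1, z.2.2.1) = x then 1 else 0| ≤ 1 := fun z => by
        obtain ⟨ha, hb⟩ := toReal_mem_unit d x
        rw [abs_le]
        split_ifs <;> constructor <;> linarith
      refine (measure_sum_ge_sqrt_le _ hn
        (fun z : S × S × A × S => (d x).toReal - if (z.2.1, z.2.2.1) = x then 1 else 0) hb ?_
        (hvpos x hx) ?_ hL (by linarith [hbig x hx])).trans (ENNReal.ofReal_le_ofReal ?_)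
      · rw [pexp_sampleDist, ← hddef]
        simp only [pexp_const, Prod.mk.eta]
        rw [pexp_sub, pexp_const, pexp_ite_eq, mul_one, sub_self]
      · rw [pexp_sampleDist, ← hddef]
        simp only [pexp_const, Prod.mk.eta]
        have e : (fun z => ((d x).toReal - if z = x then (1 : ℝ) else 0) ^ 2)
            = fun z => (d x).toReal ^ 2 + if z = x then 1 - 2 * (d x).toReal else 0 := by
          ext z
          split_ifs <;> ring
        rw [e, pexp_add, pexp_const, pexp_ite_eq]
        nlinarith [sq_nonneg (d x).toReal]
      · rw [hexp]
        exact mul_le_of_le_one_left (by positivity) hp1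
    · rw [← hexp]
      have hb : ∀ z : S × S × A × S, |if (z.2.1, z.2.2.1) = x then
          ((P x.1 x.2 y).toReal - if z.2.2.2 = y then 1 else 0) else 0| ≤ 1 := fun z => by
        obtain ⟨ha, hb⟩ := toReal_mem_unit (P x.1 x.2) y
        rw [abs_le]
        split_ifs <;> constructor <;> linarith
      refine measure_sum_ge_sqrt_le _ hn
        (fun z : S × S × A × S => if (z.2.1, z.2.2.1) = x then
          ((P x.1 x.2 y).toReal - if z.2.2.2 = y then 1 else 0) else 0) hb ?_
        (hvpos x hx) ?_ hL (by linarith [hbig x hx])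
      · rw [pexp_sampleDist, ← hddef]
        refine (congrArg (pexp ρ0) (funext fun s0 => ?_)).trans (pexp_const ρ0 0)
        refine (congrArg (pexp d) (funext fun z => ?_)).trans (pexp_const d 0)
        by_cases hz : z = x
        · subst hz
          simp only [Prod.mk.eta, if_true]
          rw [pexp_sub, pexp_const, pexp_ite_eq, mul_one, sub_self]
        · simp only [Prod.mk.eta, hz, if_false, pexp_const]
      · rw [pexp_sampleDist, ← hddef]
        refine pexp_le_const _ fun s0 => ?_
        refine (pexp_mono d (g := fun z => if z = x then 1 else 0) fun z => ?_).trans_eq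
          ((pexp_ite_eq d x 1).trans (mul_one _))
        refine pexp_le_const _ fun y' => ?_
        by_cases hz : z = x
        · exact ((sq_le_one_iff_abs_le_one _).2 (hb (s0, z.1, z.2, y'))).trans_eq (if_pos hz).symm
        · simp [hz]
  · refine (measure_mono_null ?_ measure_empty).trans_le zero_le
    intro D hD
    refine hD fun x _ => (DTV_le_one _ _).trans ?_
    have h2 : 1 / 4 ≤ √(L / (dmin * n)) := by
      refine Real.le_sqrt_of_sq_le ?_
      rw [le_div_iff₀ hdn]
      linarith
    have h3 : 4 ≤ 4 / pmin := (le_div_iff₀ hp).2 (by linarith)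
    nlinarith

end Sampling

lemma one_sub_le_measure_of_bad {Ω : Type*} [MeasurableSpace Ω] (μ : Measure Ω)
    [IsProbabilityMeasure μ] {δ : ℝ} (hδ : 0 ≤ δ) {p q s : Ω → Prop} {G : Set Ω}
    (hp : μ {ω | ¬ p ω} ≤ ENNReal.ofReal δ)
    (hq : μ {ω | ¬ q ω} ≤ ENNReal.ofReal δ + ENNReal.ofReal δ) (hs : ∀ᵐ ω ∂μ, s ω)
    (hG : ∀ ω, p ω → q ω → s ω → ω ∈ G) : ENNReal.ofReal (1 - 4 * δ) ≤ μ G := by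
  have hcover : (Set.univ : Set Ω) ⊆ G ∪ ({ω | ¬ p ω} ∪ ({ω | ¬ q ω} ∪ {ω | ¬ s ω})) := by
    intro ω _
    by_contra hcon
    simp only [Set.mem_union, Set.mem_ofPred_eq, not_or, not_not] at hcon
    exact hcon.1 (hG ω hcon.2.1 hcon.2.2.1 hcon.2.2.2)
  have h : 1 ≤ μ G + ENNReal.ofReal (3 * δ) := by
    rw [← measure_univ (μ := μ)]
    refine (measure_mono hcover).trans ((measure_union_le _ _).trans ?_)
    gcongr
    refine (measure_union_le _ _).trans
      ((add_le_add hp ((measure_union_le _ _).trans (add_le_add hq (ae_iff.1 hs).le))).trans_eq ?_)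
    rw [add_zero, ← ENNReal.ofReal_add hδ hδ, ← ENNReal.ofReal_add hδ (by linarith)]
    ring_nf
  calc ENNReal.ofReal (1 - 4 * δ) ≤ ENNReal.ofReal (1 - 3 * δ) :=
        ENNReal.ofReal_le_ofReal (by linarith)
    _ = 1 - ENNReal.ofReal (3 * δ) := by
        rw [ENNReal.ofReal_sub _ (by linarith), ENNReal.ofReal_one]
    _ ≤ μ G := tsub_le_iff_right.2 h

/-- **Lemma 1, part (ii): suboptimality upper bound for MOReL.** Under the setup of
Lemma 1 part (i), with probability at least `1 - C·δ` the output policy additionally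
satisfies the suboptimality bound against the optimal policy `π*`, in terms of the
discounted hitting time of the unknown set, which is in turn bounded via the
discounted visitation of the unknown set. -/
theorem morel_suboptimality_upper_bound :
    ∃ C : ℝ, 1 ≤ C ∧
      ∀ (S A : Type) (_ : Fintype S) (_ : Fintype A)
        (_ : DecidableEq S) (_ : DecidableEq A) (_ : Nonempty S) (_ : Nonempty A)
        (P : S → A → PMF S) (ρ0 : PMF S)
        (r : S → A → ℝ) (Rmax : ℝ), (∀ s a, |r s a| ≤ Rmax) →
      ∀ (γ : ℝ) (hγ0 : 0 ≤ γ) (hγ1 : γ < 1) (πb : S → PMF A)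
        (ρmin pmin dmin : ℝ),
        0 < ρmin → (∀ s, ρ0 s ≠ 0 → ρmin ≤ (ρ0 s).toReal) →
        0 < pmin → (∀ s a s', P s a s' ≠ 0 → pmin ≤ (P s a s' : ℝ≥0∞).toReal) →
        0 < dmin →
        (∀ sa, visitPMF ρ0 πb P γ hγ0 hγ1 sa ≠ 0 →
          dmin ≤ (visitPMF ρ0 πb P γ hγ0 hγ1 sa).toReal) →
      ∀ (πstar : S → PMF A), (∀ π' : S → PMF A, J ρ0 π' P γ r ≤ J ρ0 πstar P γ r) →
      ∀ (δ : ℝ), 0 < δ →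
      ∀ (n : ℕ) (hn0 : 0 < n),
        (C / dmin ^ 2) * Real.log (1 / (δ * dmin)) ≤ (n : ℝ) →
      letI : MeasurableSpace (S × S × A × S) := ⊤
      ENNReal.ofReal (1 - C * δ) ≤
        Measure.pi (fun _ : Fin n => (sampleDist ρ0 πb P γ hγ0 hγ1).toMeasure)
          {D : Fin n → S × S × A × S |
            ∀ (επ : ℝ) (πout : Option S → PMF A),
              (∀ πe : Option S → PMF A,
                J ((empInit hn0 D).map some) πe
                    (pessKernel (empKernel D)
                      {sa : S × A |
                        (C / pmin) *
                            Real.sqrt (Real.log (1 / (δ * pmin * dmin)) / (countSA D sa))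
                          < DTV (empKernel D sa.1 sa.2) (P sa.1 sa.2)})
                    γ (pessReward r Rmax)
                  ≤ J ((empInit hn0 D).map some) πout
                      (pessKernel (empKernel D)
                        {sa : S × A |
                          (C / pmin) *
                              Real.sqrt
                                (Real.log (1 / (δ * pmin * dmin)) / (countSA D sa))
                            < DTV (empKernel D sa.1 sa.2) (P sa.1 sa.2)})
                      γ (pessReward r Rmax) + επ) →
              (J ρ0 πstar P γ r - J ρ0 (fun s => πout (some s)) P γ r
                ≤ επ + (2 * Rmax / (1 - γ)) *
                    discHit ρ0 πstar P γ
                      {sa : S × A |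
                        (C / pmin) *
                            Real.sqrt (Real.log (1 / (δ * pmin * dmin)) / (countSA D sa))
                          < DTV (empKernel D sa.1 sa.2) (P sa.1 sa.2)}
                  + ((4 * C * Rmax / ((1 - γ) * ρmin)) *
                        Real.sqrt (Real.log (1 / (δ * ρmin)) / n) +
                      (4 * C * γ * Rmax / ((1 - γ) ^ 2 * pmin)) *
                        Real.sqrt (Real.log (1 / (δ * pmin * dmin)) / (dmin * n)))) ∧
              (επ + (2 * Rmax / (1 - γ)) *
                    discHit ρ0 πstar P γ
                      {sa : S × A |
                        (C / pmin) *
                            Real.sqrt (Real.log (1 / (δ * pmin * dmin)) / (countSA D sa))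
                          < DTV (empKernel D sa.1 sa.2) (P sa.1 sa.2)}
                  + ((4 * C * Rmax / ((1 - γ) * ρmin)) *
                        Real.sqrt (Real.log (1 / (δ * ρmin)) / n) +
                      (4 * C * γ * Rmax / ((1 - γ) ^ 2 * pmin)) *
                        Real.sqrt (Real.log (1 / (δ * pmin * dmin)) / (dmin * n)))
                ≤ επ + (2 * Rmax / (1 - γ) ^ 2) *
                    dVisitSet ρ0 πstar P γ
                      {sa : S × A |
                        (C / pmin) *
                            Real.sqrt (Real.log (1 / (δ * pmin * dmin)) / (countSA D sa))
                          < DTV (empKernel D sa.1 sa.2) (P sa.1 sa.2)}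
                  + ((4 * C * Rmax / ((1 - γ) * ρmin)) *
                        Real.sqrt (Real.log (1 / (δ * ρmin)) / n) +
                      (4 * C * γ * Rmax / ((1 - γ) ^ 2 * pmin)) *
                        Real.sqrt (Real.log (1 / (δ * pmin * dmin)) / (dmin * n))))} := by
  refine ⟨4, by norm_num, ?_⟩
  intro S A _ _ _ _ _ _ P ρ0 r Rmax hr γ hγ0 hγ1 πb ρmin pmin dmin hρ hρmin hp hpmin hd hdmin
    πstar _ δ hδ n hn0 _
  let : MeasurableSpace (S × S × A × S) := ⊤
  rcases le_or_gt 1 δ with hδ1 | hδ1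
  · rw [ENNReal.ofReal_of_nonpos (by linarith)]
    exact zero_le
  have hR : 0 ≤ Rmax :=
    (abs_nonneg _).trans (hr (Classical.arbitrary S) (Classical.arbitrary A))
  have h1γ : 0 < 1 - γ := by linarith
  set μ := Measure.pi (fun _ : Fin n => (sampleDist ρ0 πb P γ hγ0 hγ1).toMeasure)
  refine one_sub_le_measure_of_bad μ hδ.le
    (measure_empInit_le ρ0 πb P hγ0 hγ1 hρ hρmin hδ hδ1.le hn0)
    (measure_empKernel_le ρ0 πb P hγ0 hγ1 hp hpmin hd hdmin hδ hδ1.le hn0)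
    (ae_forall_pmf_ne_zero (sampleDist ρ0 πb P γ hγ0 hγ1) n) ?_
  intro D hinit hker hsupp επ πout hopt
  generalize hU : {sa : S × A | (4 / pmin) *
    Real.sqrt (Real.log (1 / (δ * pmin * dmin)) / (countSA D sa))
      < DTV (empKernel D sa.1 sa.2) (P sa.1 sa.2)} = U at hopt ⊢
  have hβ : 0 ≤ 4 / pmin * √(Real.log (1 / (δ * pmin * dmin)) / (dmin * n)) := by positivity
  have hknown : ∀ s a, (s, a) ∉ U → DTV (empKernel D s a) (P s a)
      ≤ 4 / pmin * √(Real.log (1 / (δ * pmin * dmin)) / (dmin * n)) := by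
    intro s a hsa
    by_cases hv : visitPMF ρ0 πb P γ hγ0 hγ1 (s, a) = 0
    · have hc : countSA D (s, a) = 0 := by
        rw [countSA, Finset.card_eq_zero, Finset.filter_eq_empty_iff]
        intro i _ hi
        have := visitPMF_ne_zero_of_sampleDist ρ0 πb P hγ0 hγ1 (hsupp i)
        rw [hi] at this
        exact this hv
      rw [← hU, Set.mem_ofPred_eq, not_lt, hc, Nat.cast_zero, div_zero, Real.sqrt_zero,
        mul_zero] at hsa
      exact hsa.trans hβ
    · exact hker (s, a) hv
  refine ⟨(suboptimality_of_estimates ρ0 (empInit hn0 D) P (empKernel D) hγ0 hγ1 hR hr U hβ hknown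
    hinit πstar πout hopt).trans_eq ?_, ?_⟩
  · congr 2
    · field_simp
    · field_simp
  · have hvisit : 2 * Rmax / (1 - γ) * discHit ρ0 πstar P γ U
        ≤ 2 * Rmax / (1 - γ) ^ 2 * dVisitSet ρ0 πstar P γ U :=
      (mul_le_mul_of_nonneg_left (discHit_le_dVisitSet ρ0 πstar P hγ0 hγ1 U)
        (by positivity)).trans_eq (by field_simp)
    linarith

end MOReL
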